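/- Let f be a WG-drawing with witness set P ⊆ ℝ² of a finite complete bipartite graph G with color map c, and assume the image of f and P are linearly separable. Let u0, v0, u1, v1 be four distinct vertices with c(u0) = c(u1) ≠ c(v0) = c(v1), so that u0, v0, u1, v1 form a 4-cycle of edges of G. Then the quadrilateral f(u0) f(v0) f(u1) f(v1) is convex; equivalently, the open segments (f(u0), f(u1)) and (f(v0), f(v1)) intersect. -/

import Mathlib

noncomputable section

/-- The Euclidean plane. -/
abbrev Pt : Type := EuclideanSpace ℝ (Fin 2)

/-- The Gabriel disk `D[u,v]`: the closed disk having `u` and `v` as antipodal points. -/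
def gabrielDisk (u v : Pt) : Set Pt := Metric.closedBall (midpoint ℝ u v) (dist u v / 2)

/-- `f` is a witness Gabriel drawing of the finite simple graph `G` with witness set `P`. -/
def IsWGDrawing {V : Type*} [Fintype V] (G : SimpleGraph V) (f : V → Pt) (P : Set Pt) : Prop :=
  Function.Injective f ∧ Disjoint (Set.range f) P ∧
    ∀ u v : V, u ≠ v → (G.Adj u v ↔ gabrielDisk (f u) (f v) ∩ P = ∅)

/-- `⟨f₀, f₁⟩` is a mutual witness Gabriel drawing of the pair `⟨G₀, G₁⟩`. -/
def IsMWGDrawing {V₀ V₁ : Type*} [Fintype V₀] [Fintype V₁]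
    (G₀ : SimpleGraph V₀) (G₁ : SimpleGraph V₁) (f₀ : V₀ → Pt) (f₁ : V₁ → Pt) : Prop :=
  Function.Injective f₀ ∧ Function.Injective f₁ ∧
    Disjoint (Set.range f₀) (Set.range f₁) ∧
    (∀ u v : V₀, u ≠ v → (G₀.Adj u v ↔ gabrielDisk (f₀ u) (f₀ v) ∩ Set.range f₁ = ∅)) ∧
    (∀ u v : V₁, u ≠ v → (G₁.Adj u v ↔ gabrielDisk (f₁ u) (f₁ v) ∩ Set.range f₀ = ∅))

/-- Two subsets of the plane are linearly separable. -/
def LinSep (A B : Set Pt) : Prop :=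
  ∃ (φ : Pt →ₗ[ℝ] ℝ) (c : ℝ), φ ≠ 0 ∧ (∀ a ∈ A, φ a < c) ∧ ∀ b ∈ B, c < φ b

/-- Twice the signed area of the triangle `a b c`. -/
def orient (a b c : Pt) : ℝ := (b 0 - a 0) * (c 1 - a 1) - (b 1 - a 1) * (c 0 - a 0)

/-- The inner product of `a - p` and `b - p`. -/
def dotAt (p a b : Pt) : ℝ := (a 0 - p 0) * (b 0 - p 0) + (a 1 - p 1) * (b 1 - p 1)

/-- The affine function on the plane with linear part `(l, m)` and constant part `-k`. -/
def affineFun (l m k : ℝ) (x : Pt) : ℝ := l * x 0 + m * x 1 - k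

lemma mem_gabrielDisk_iff (u v p : Pt) : p ∈ gabrielDisk u v ↔ dotAt p u v ≤ 0 := by
  have hm : ∀ i, (midpoint ℝ u v) i = (u i + v i) / 2 := by
    intro i
    rw [midpoint_eq_smul_add]
    simp
    ring
  have hr : dist u v / 2 = √(((u 0 - v 0) ^ 2 + (u 1 - v 1) ^ 2) / 4) := by
    rw [Real.sqrt_div' _ (by norm_num), show (4 : ℝ) = 2 ^ 2 by norm_num,
      Real.sqrt_sq (by norm_num), EuclideanSpace.dist_eq]
    simp [Fin.sum_univ_two, Real.dist_eq]
  rw [gabrielDisk, Metric.mem_closedBall, hr, EuclideanSpace.dist_eq,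
    Real.sqrt_le_sqrt_iff (by positivity)]
  simp only [Fin.sum_univ_two, Real.dist_eq, sq_abs, hm, dotAt]
  constructor <;> intro h <;> linarith

/-- The point `p` lies in the Gabriel disk of `a, b` and in none of those of `a, c`; `a, d`;
`b, c`; `b, d`. -/
structure Witnesses (p a b c d : Pt) : Prop where
  ab : dotAt p a b ≤ 0
  ac : 0 < dotAt p a c
  ad : 0 < dotAt p a d
  bc : 0 < dotAt p b c
  bd : 0 < dotAt p b d

lemma dotAt_comm (p a b : Pt) : dotAt p a b = dotAt p b a := by
  unfold dotAt; ring

lemma Witnesses.swap_left {p a b c d : Pt} (h : Witnesses p a b c d) : Witnesses p b a c d :=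
  ⟨by rw [dotAt_comm]; exact h.ab, h.bc, h.bd, h.ac, h.ad⟩

lemma Witnesses.swap_right {p a b c d : Pt} (h : Witnesses p a b c d) : Witnesses p a b d c :=
  ⟨h.ab, h.ad, h.ac, h.bd, h.bc⟩

/-- Two points `p, q` on the positive side of a line that witness the non-edges `a b` and `c d` of
a 4-cycle `a c b d` drawn on the negative side of that line. -/
structure WitnessedCycle (l m k : ℝ) (a b c d p q : Pt) : Prop where
  a_neg : affineFun l m k a < 0
  b_neg : affineFun l m k b < 0
  c_neg : affineFun l m k c < 0
  d_neg : affineFun l m k d < 0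
  p_pos : 0 < affineFun l m k p
  q_pos : 0 < affineFun l m k q
  p_wit : Witnesses p a b c d
  q_wit : Witnesses q c d a b

namespace WitnessedCycle

variable {l m k : ℝ} {a b c d p q : Pt}

lemma swap_ab (h : WitnessedCycle l m k a b c d p q) : WitnessedCycle l m k b a c d p q :=
  ⟨h.b_neg, h.a_neg, h.c_neg, h.d_neg, h.p_pos, h.q_pos, h.p_wit.swap_left, h.q_wit.swap_right⟩

lemma swap_cd (h : WitnessedCycle l m k a b c d p q) : WitnessedCycle l m k a b d c p q :=
  ⟨h.a_neg, h.b_neg, h.d_neg, h.c_neg, h.p_pos, h.q_pos, h.p_wit.swap_right, h.q_wit.swap_left⟩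

lemma swap_pairs (h : WitnessedCycle l m k a b c d p q) : WitnessedCycle l m k c d a b q p :=
  ⟨h.c_neg, h.d_neg, h.a_neg, h.b_neg, h.q_pos, h.p_pos, h.q_wit, h.p_wit⟩

end WitnessedCycle

/-- A point seen from `p` at acute angles from both `a` and `b`, where `a` and `b` are seen at a
non-acute angle and everything lies in a half-plane, lies strictly inside the angle `a p b`. -/
lemma mem_angle {l m k : ℝ} {p a b c : Pt} (hp : 0 < affineFun l m k p)
    (ha : affineFun l m k a < 0) (hb : affineFun l m k b < 0) (hc : affineFun l m k c < 0)
    (hab : dotAt p a b ≤ 0) (hac : 0 < dotAt p a c) (hbc : 0 < dotAt p b c) :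
    0 < orient p a b * orient p a c ∧ 0 < orient p a b * orient p c b := by
  have ha' : affineFun l m k a - affineFun l m k p < 0 := by linarith
  have hb' : affineFun l m k b - affineFun l m k p < 0 := by linarith
  have hc' : affineFun l m k c - affineFun l m k p < 0 := by linarith
  have haa : 0 ≤ dotAt p a a := by unfold dotAt; nlinarith
  have hbb : 0 ≤ dotAt p b b := by unfold dotAt; nlinarith
  have eac : orient p a b ^ 2 * dotAt p a c =
      (orient p a b * orient p c b) * dotAt p a a
        + (orient p a b * orient p a c) * dotAt p a b := by
    unfold orient dotAt; ring
  have ebc : orient p a b ^ 2 * dotAt p b c =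
      (orient p a b * orient p c b) * dotAt p a b
        + (orient p a b * orient p a c) * dotAt p b b := by
    unfold orient dotAt; ring
  have ec : orient p a b ^ 2 * (affineFun l m k c - affineFun l m k p) =
      (orient p a b * orient p c b) * (affineFun l m k a - affineFun l m k p)
        + (orient p a b * orient p a c) * (affineFun l m k b - affineFun l m k p) := by
    unfold orient affineFun; ring
  have eb : dotAt p a a * (affineFun l m k b - affineFun l m k p) =
      dotAt p a b * (affineFun l m k a - affineFun l m k p)
        + orient p a b * (m * (a 0 - p 0) - l * (a 1 - p 1)) := by
    unfold orient dotAt affineFun; ring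
  have hne : orient p a b ≠ 0 := by
    intro h0
    rw [h0, zero_mul, add_zero] at eb
    have h1 : dotAt p a a = 0 := by
      have := mul_nonneg_of_nonpos_of_nonpos hab ha'.le
      nlinarith
    unfold dotAt at h1 hac
    have h2 : a 0 - p 0 = 0 := by nlinarith
    have h3 : a 1 - p 1 = 0 := by nlinarith
    rw [h2, h3] at hac
    simp at hac
  have hsq : 0 < orient p a b ^ 2 := by positivity
  have pac := mul_pos hsq hac
  have pbc := mul_pos hsq hbc
  have pc := mul_neg_of_pos_of_neg hsq hc'
  generalize orient p a b * orient p a c = y at *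
  generalize orient p a b * orient p c b = x at *
  by_contra hcon
  have hxy : x ≤ 0 ∧ y ≤ 0 := by
    rcases le_or_gt x 0 with hx | hx
    · refine ⟨hx, ?_⟩
      by_contra! hy
      nlinarith [mul_nonpos_of_nonpos_of_nonneg hx haa,
        mul_nonpos_of_nonneg_of_nonpos hy.le hab]
    · rcases le_or_gt y 0 with hy | hy
      · nlinarith [mul_nonpos_of_nonpos_of_nonneg hy hbb,
          mul_nonpos_of_nonneg_of_nonpos hx.le hab]
      · exact absurd ⟨hy, hx⟩ hcon
  nlinarith [mul_nonneg_of_nonpos_of_nonpos hxy.1 ha'.le,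
    mul_nonneg_of_nonpos_of_nonpos hxy.2 hb'.le]

namespace WitnessedCycle

variable {l m k : ℝ} {a b c d p q : Pt}

lemma mem_angle_p (h : WitnessedCycle l m k a b c d p q) :
    0 < orient p a b * orient p a c ∧ 0 < orient p a b * orient p c b :=
  mem_angle h.p_pos h.a_neg h.b_neg h.c_neg h.p_wit.ab h.p_wit.ac h.p_wit.bc

/-- The point `c` is strictly inside the angle `a p b`, whereas `a` is on its boundary and `a`, `b`
are strictly inside the angle `c q d`; so `a, b, c` are not collinear. -/
lemma orient_abc_ne (h : WitnessedCycle l m k a b c d p q) : orient a b c ≠ 0 := by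
  intro h0
  have h1 := h.mem_angle_p
  have h2 := h.swap_pairs.mem_angle_p
  have h3 := h.swap_ab.swap_pairs.mem_angle_p
  have e1 : orient p a b = orient p a c + orient p c b + orient a b c := by
    unfold orient; ring
  have e2 : orient p a b * orient q c d * orient q c c =
      orient p c b * orient q c d * orient q c a
        + orient p a c * orient q c d * orient q c b
        + orient q c d * (orient p a b - orient p a c - orient p c b) * orient q c p := by
    unfold orient; ring
  have e3 : orient q c c = 0 := by unfold orient; ring
  rw [e3, show orient p a b - orient p a c - orient p c b = 0 by linarith] at e2
  have h4 := mul_pos h1.2 h2.1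
  have h5 := mul_pos h1.1 h3.1
  have e4 : orient p a b * (orient p c b * orient q c d * orient q c a
        + orient p a c * orient q c d * orient q c b) = 0 := by
    linear_combination (-orient p a b) * e2
  linarith

/-- No linear dependence has the same sign on the three points `b, c, d`, which lie strictly on
one side of the line `p a`. -/
lemma not_same_sign (h : WitnessedCycle l m k a b c d p q) {s : ℝ} :
    ¬ (0 < s * -orient a c d ∧ 0 < s * orient a b d ∧ 0 < s * -orient a b c) := by
  rintro ⟨h1, h2, h3⟩
  have hc := h.mem_angle_p.1
  have hd := h.swap_cd.mem_angle_p.1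
  have e : orient p a b * orient p a b * (s * -orient a c d)
      + orient p a b * orient p a c * (s * orient a b d)
      + orient p a b * orient p a d * (s * -orient a b c) = 0 := by
    unfold orient; ring
  have := mul_nonneg (mul_self_nonneg (orient p a b)) h1.le
  linarith [mul_pos hc h2, mul_pos hd h3]

/-- The case of a counterclockwise convex quadrilateral `a b c d` where `p` looks at it through the
side `a b`, while `q` lies beyond the intersection point of the lines `d a` and `c b`. -/
lemma false_of_same_side (h : WitnessedCycle l m k a b c d p q)
    (h1 : 0 < orient a b c) (h2 : 0 < orient b c d) (h3 : 0 < orient c d a)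
    (h4 : 0 < orient d a b)
    (p1 : 0 < orient d a p) (p2 : 0 < orient b c p) (p3 : orient a b p < 0)
    (q1 : orient d a q < 0) (q2 : orient b c q < 0) (q4 : 0 < orient c d q) : False := by
  have hS : 0 < orient a b c + orient c d a := by linarith
  have eq : orient b c d * orient c d a * (orient a b c + orient c d a) =
      (orient a b c + orient c d a) *
        (orient c d a * orient b c q + orient b c d * orient d a q)
      + (orient c d a - orient d a b) * (orient a b c + orient c d a) * orient c d q := by
    unfold orient; ring
  have hκ : 0 < orient c d a - orient d a b := by
    by_contra! hle
    have t1 := mul_pos (mul_pos h2 h3) hS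
    have t2 := mul_neg_of_pos_of_neg h3 q2
    have t3 := mul_neg_of_pos_of_neg h2 q1
    have t4 := mul_neg_of_pos_of_neg hS (add_neg t2 t3)
    have t5 := mul_nonpos_of_nonpos_of_nonneg (mul_nonpos_of_nonpos_of_nonneg hle hS.le) q4.le
    linarith
  have ep : orient a b c * orient d a b =
      orient a b c * orient d a p + orient d a b * orient b c p
        - (orient c d a - orient d a b) * orient a b p := by
    unfold orient; ring
  have hp : orient d a p - orient d a b < 0 := by
    have := mul_neg_of_pos_of_neg hκ p3
    have := mul_pos h4 p2
    nlinarith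
  have fp : (orient c d a - orient d a b) * (dotAt p a b - dotAt p b d) =
      orient b c p * dotAt a d d
        + (orient d a p - orient d a b) *
          ((d 0 - a 0) * (c 0 - b 0) + (d 1 - a 1) * (c 1 - b 1)) := by
    unfold orient dotAt; ring
  have fq : -(orient c d a - orient d a b) * (dotAt q c d - dotAt q a c) =
      orient b c q * dotAt a d d
        + (orient d a q - orient c d a) *
          ((d 0 - a 0) * (c 0 - b 0) + (d 1 - a 1) * (c 1 - b 1)) := by
    unfold orient dotAt; ring
  have hdd : 0 ≤ dotAt a d d := by unfold dotAt; nlinarith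
  generalize (d 0 - a 0) * (c 0 - b 0) + (d 1 - a 1) * (c 1 - b 1) = t at fp fq
  have gp : dotAt p a b - dotAt p b d < 0 := by linarith [h.p_wit.ab, h.p_wit.bd]
  have gq : dotAt q c d - dotAt q a c < 0 := by
    linarith [h.q_wit.ab, h.q_wit.ac, dotAt_comm q a c]
  have ht : 0 < t := by
    by_contra! hle
    nlinarith [mul_nonneg p2.le hdd, mul_nonneg_of_nonpos_of_nonpos hp.le hle,
      mul_neg_of_pos_of_neg hκ gp]
  nlinarith [mul_nonpos_of_nonpos_of_nonneg q2.le hdd, mul_neg_of_pos_of_neg hκ gq,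
    mul_neg_of_neg_of_pos (show orient d a q - orient c d a < 0 by linarith) ht]

/-- If `p` and `q` look at the quadrilateral `a b c d` through opposite sides, then they cannot be
separated from it by a line. -/
lemma false_of_opposite_sides (h : WitnessedCycle l m k a b c d p q)
    (h1 : 0 < orient a b c) (h2 : 0 < orient b c d) (h3 : 0 < orient c d a)
    (h4 : 0 < orient d a b)
    (p1 : 0 < orient d a p) (p2 : 0 < orient b c p) (p3 : orient a b p < 0)
    (q1 : 0 < orient d a q) (q2 : 0 < orient b c q) (q4 : orient c d q < 0) : False := by
  have eq : orient b c d * orient c d a * orient a b q =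
      orient a b c * orient b c d * orient d a q + orient d a b * orient c d a * orient b c q
        - orient a b c * orient d a b * orient c d q := by
    unfold orient; ring
  have q3 : 0 < orient a b q := by
    by_contra! hle
    linarith [mul_pos (mul_pos h1 h2) q1, mul_pos (mul_pos h4 h3) q2,
      mul_neg_of_pos_of_neg (mul_pos h1 h4) q4,
      mul_nonpos_of_nonneg_of_nonpos (mul_pos h2 h3).le hle]
  have e : orient a b c * orient d a b *
      (orient a b q * affineFun l m k p - orient a b p * affineFun l m k q) =
      orient d a b * affineFun l m k a *
        (orient a b q * orient b c p - orient a b p * orient b c q)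
      + orient a b c * affineFun l m k b *
        (orient a b q * orient d a p - orient a b p * orient d a q) := by
    unfold orient affineFun; ring
  have r1 : 0 < orient a b q * affineFun l m k p - orient a b p * affineFun l m k q := by
    linarith [mul_pos q3 h.p_pos, mul_neg_of_neg_of_pos p3 h.q_pos]
  have r2 : 0 < orient a b q * orient b c p - orient a b p * orient b c q := by
    linarith [mul_pos q3 p2, mul_neg_of_neg_of_pos p3 q2]
  have r3 : 0 < orient a b q * orient d a p - orient a b p * orient d a q := by
    linarith [mul_pos q3 p1, mul_neg_of_neg_of_pos p3 q1]
  linarith [mul_pos (mul_pos h1 h4) r1,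
    mul_neg_of_neg_of_pos (mul_neg_of_pos_of_neg h4 h.a_neg) r2,
    mul_neg_of_neg_of_pos (mul_neg_of_pos_of_neg h1 h.b_neg) r3]

/-- The point `p` looks at a counterclockwise convex quadrilateral `a b c d` through the side `a b`,
or else lies beyond the intersection point of the lines `a d` and `b c`. -/
lemma side_or_beyond (h : WitnessedCycle l m k a b c d p q) :
    (0 < orient d a p ∧ 0 < orient b c p ∧ orient a b p < 0) ∨
      (orient d a p < 0 ∧ orient b c p < 0 ∧ 0 < orient a b p) := by
  have hc := h.mem_angle_p.2
  have hd := h.swap_cd.mem_angle_p.1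
  have e1 : orient d a p = -orient p a d := by unfold orient; ring
  have e2 : orient b c p = -orient p c b := by unfold orient; ring
  have e3 : orient a b p = orient p a b := by unfold orient; ring
  rw [e1, e2, e3]
  rcases mul_pos_iff.1 hc with ⟨x, y⟩ | ⟨x, y⟩
  · exact Or.inr ⟨by linarith [pos_of_mul_pos_right hd x.le], by linarith, x⟩
  · exact Or.inl ⟨by linarith [neg_of_mul_pos_right hd x.le], by linarith, x⟩

lemma not_ccw (h : WitnessedCycle l m k a b c d p q)
    (h1 : 0 < orient a b c) (h2 : 0 < orient b c d) (h3 : 0 < orient c d a)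
    (h4 : 0 < orient d a b) : False := by
  rcases h.side_or_beyond with ⟨p1, p2, p3⟩ | ⟨p1, p2, p3⟩ <;>
    rcases h.swap_pairs.side_or_beyond with ⟨q2, q1, q4⟩ | ⟨q2, q1, q4⟩
  · exact h.false_of_opposite_sides h1 h2 h3 h4 p1 p2 p3 q1 q2 q4
  · exact h.false_of_same_side h1 h2 h3 h4 p1 p2 p3 q1 q2 q4
  · exact h.swap_pairs.false_of_same_side h3 h4 h1 h2 q2 q1 q4 p2 p1 p3
  · have ep : orient a b c * orient d a b =
        orient a b c * orient d a p + orient d a b * orient b c p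
          - (orient c d a - orient d a b) * orient a b p := by
      unfold orient; ring
    have eq : orient b c d * orient c d a =
        orient c d a * orient b c q + orient b c d * orient d a q
          + (orient c d a - orient d a b) * orient c d q := by
      unfold orient; ring
    rcases le_total (orient c d a - orient d a b) 0 with hk | hk
    · linarith [mul_pos h2 h3, mul_neg_of_pos_of_neg h3 q2, mul_neg_of_pos_of_neg h2 q1,
        mul_nonpos_of_nonpos_of_nonneg hk q4.le]
    · linarith [mul_pos h1 h4, mul_neg_of_pos_of_neg h1 p1, mul_neg_of_pos_of_neg h4 p2,
        mul_nonneg hk p3.le]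

end WitnessedCycle

lemma orient_rotate (a b c : Pt) : orient b c a = orient a b c := by
  unfold orient; ring

lemma orient_swap (a b c : Pt) : orient b a c = -orient a b c := by
  unfold orient; ring

lemma orient_swap_right (a b c : Pt) : orient a c b = -orient a b c := by
  unfold orient; ring

/-- The open segments `a b` and `c d` cross if the affine dependence between the four points has
one sign on `a, b` and the other one on `c, d`. -/
lemma openSegment_inter_nonempty {a b c d : Pt} {s : ℝ} (ha : 0 < s * orient b c d)
    (hb : 0 < s * -orient a c d) (hc : 0 < s * -orient a b d) (hd : 0 < s * orient a b c) :
    (openSegment ℝ a b ∩ openSegment ℝ c d).Nonempty := by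
  have e : s * orient b c d + s * -orient a c d = s * -orient a b d + s * orient a b c := by
    unfold orient; ring
  have hS := add_pos ha hb
  refine ⟨(s * orient b c d / (s * orient b c d + s * -orient a c d)) • a
    + (s * -orient a c d / (s * orient b c d + s * -orient a c d)) • b,
    ⟨_, _, div_pos ha hS, div_pos hb hS, by rw [← add_div, div_self hS.ne'], rfl⟩,
    ⟨_, _, div_pos hc hS, div_pos hd hS, by rw [← add_div, ← e, div_self hS.ne'], ?_⟩⟩
  ext i
  simp only [PiLp.add_apply, PiLp.smul_apply, smul_eq_mul]
  rw [div_mul_eq_mul_div, div_mul_eq_mul_div, div_mul_eq_mul_div, div_mul_eq_mul_div,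
    ← add_div, ← add_div]
  congr 1
  fin_cases i <;> simp [orient] <;> ring

lemma WitnessedCycle.openSegment_inter {l m k : ℝ} {a b c d p q : Pt}
    (h : WitnessedCycle l m k a b c d p q) :
    (openSegment ℝ a b ∩ openSegment ℝ c d).Nonempty := by
  have nd := h.orient_abc_ne
  have nc := h.swap_cd.orient_abc_ne
  have nb := h.swap_pairs.orient_abc_ne
  have na := h.swap_ab.swap_pairs.orient_abc_ne
  have ea := h.swap_ab.not_same_sign (s := 1)
  have ea' := h.swap_ab.not_same_sign (s := -1)
  have eb := h.not_same_sign (s := 1)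
  have eb' := h.not_same_sign (s := -1)
  have ec := h.swap_cd.swap_pairs.not_same_sign (s := 1)
  have ec' := h.swap_cd.swap_pairs.not_same_sign (s := -1)
  have ed := h.swap_pairs.not_same_sign (s := 1)
  have ed' := h.swap_pairs.not_same_sign (s := -1)
  have n1 := h.not_ccw
  have n2 := h.swap_ab.swap_cd.not_ccw
  have n3 := h.swap_cd.not_ccw
  have n4 := h.swap_ab.not_ccw
  have cross := openSegment_inter_nonempty (a := a) (b := b) (c := c) (d := d) (s := 1)
  have cross' := openSegment_inter_nonempty (a := a) (b := b) (c := c) (d := d) (s := -1)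
  have r1 : orient b a c = -orient a b c := orient_swap a b c
  have r2 : orient b a d = -orient a b d := orient_swap a b d
  have r3 : orient c d a = orient a c d := orient_rotate a c d
  have r4 : orient c d b = orient b c d := orient_rotate b c d
  have r5 : orient c a b = orient a b c := by rw [← orient_rotate]
  have r6 : orient d a b = orient a b d := by rw [← orient_rotate]
  have r7 : orient d c a = -orient a c d := by rw [orient_swap, r3]
  have r8 : orient d c b = -orient b c d := by rw [orient_swap, r4]
  have r9 : orient a d c = -orient a c d := orient_swap_right a c d
  have r10 : orient b d c = -orient b c d := orient_swap_right b c d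
  have r11 : orient c b a = -orient a b c := by rw [orient_swap, orient_rotate]
  have r12 : orient d b a = -orient a b d := by rw [orient_swap, orient_rotate]
  simp only [r1, r2, r3, r4, r5, r6, r7, r8, r9, r10, r11, r12, one_mul, neg_mul, neg_neg,
    Left.neg_pos_iff, ne_eq] at *
  clear h r1 r2 r3 r4 r5 r6 r7 r8 r9 r10 r11 r12
  generalize (openSegment ℝ a b ∩ openSegment ℝ c d).Nonempty = goal at *
  generalize orient b c d = A at *
  generalize orient a c d = B at *
  generalize orient a b d = C at *
  generalize orient a b c = D at *
  rcases lt_or_gt_of_ne na with hA | hA <;> rcases lt_or_gt_of_ne nb with hB | hB <;>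
    rcases lt_or_gt_of_ne nc with hC | hC <;> rcases lt_or_gt_of_ne nd with hD | hD <;>
    first
    | exact cross ‹_› ‹_› ‹_› ‹_›
    | exact cross' ‹_› ‹_› ‹_› ‹_›
    | exact (n1 ‹_› ‹_› ‹_› ‹_›).elim
    | exact (n2 ‹_› ‹_› ‹_› ‹_›).elim
    | exact (n3 ‹_› ‹_› ‹_› ‹_›).elim
    | exact (n4 ‹_› ‹_› ‹_› ‹_›).elim
    | exact (ea ⟨‹_›, ‹_›, ‹_›⟩).elim
    | exact (ea' ⟨‹_›, ‹_›, ‹_›⟩).elim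
    | exact (eb ⟨‹_›, ‹_›, ‹_›⟩).elim
    | exact (eb' ⟨‹_›, ‹_›, ‹_›⟩).elim
    | exact (ec ⟨‹_›, ‹_›, ‹_›⟩).elim
    | exact (ec' ⟨‹_›, ‹_›, ‹_›⟩).elim
    | exact (ed ⟨‹_›, ‹_›, ‹_›⟩).elim
    | exact (ed' ⟨‹_›, ‹_›, ‹_›⟩).elim

/-- Corollary 2: in a linearly separable WG-drawing of a complete bipartite graph, every
4-cycle of edges is drawn as a convex quadrilateral, i.e. its diagonals cross. -/
theorem stmt7 {V : Type*} [Fintype V] (G : SimpleGraph V) (c : V → Bool)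
    (hbip : ∀ u v : V, u ≠ v → (G.Adj u v ↔ c u ≠ c v))
    (f : V → Pt) (P : Set Pt) (hWG : IsWGDrawing G f P)
    (hsep : LinSep (Set.range f) P)
    (u₀ v₀ u₁ v₁ : V)
    (h01 : u₀ ≠ u₁) (h02 : u₀ ≠ v₀) (h03 : u₀ ≠ v₁)
    (h12 : u₁ ≠ v₀) (h13 : u₁ ≠ v₁) (h23 : v₀ ≠ v₁)
    (hcu : c u₀ = c u₁) (hcv : c v₀ = c v₁) (hcuv : c u₀ ≠ c v₀) :
    (openSegment ℝ (f u₀) (f u₁) ∩ openSegment ℝ (f v₀) (f v₁)).Nonempty := by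
  obtain ⟨-, -, hadj⟩ := hWG
  obtain ⟨φ, k, -, hf, hP⟩ := hsep
  have hφ : ∀ x : Pt, affineFun (φ (EuclideanSpace.single 0 1)) (φ (EuclideanSpace.single 1 1)) k x
      = φ x - k := by
    intro x
    have hx : x = x 0 • EuclideanSpace.single 0 1 + x 1 • EuclideanSpace.single 1 1 := by
      ext i
      fin_cases i <;> simp
    conv_rhs => rw [hx, map_add, map_smul, map_smul]
    simp only [affineFun, smul_eq_mul]
    ring
  have hneg : ∀ v, affineFun (φ (EuclideanSpace.single 0 1)) (φ (EuclideanSpace.single 1 1)) k (f v)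
      < 0 := fun v ↦ by
    rw [hφ]
    linarith [hf _ (Set.mem_range_self v)]
  have hedge : ∀ u v, c u ≠ c v → ∀ p ∈ P, 0 < dotAt p (f u) (f v) := by
    intro u v huv p hp
    have hne : u ≠ v := fun h ↦ huv (congrArg c h)
    by_contra! hle
    exact Set.eq_empty_iff_forall_notMem.1 ((hadj u v hne).1 ((hbip u v hne).2 huv)) p
      ⟨(mem_gabrielDisk_iff _ _ _).2 hle, hp⟩
  have hnonedge : ∀ u v, u ≠ v → c u = c v → ∃ p ∈ P, dotAt p (f u) (f v) ≤ 0 := by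
    intro u v hne huv
    obtain ⟨p, hp, hpP⟩ := Set.nonempty_iff_ne_empty.2
      (fun h ↦ (hbip u v hne).1 ((hadj u v hne).2 h) huv)
    exact ⟨p, hpP, (mem_gabrielDisk_iff _ _ _).1 hp⟩
  obtain ⟨p, hp, hpu⟩ := hnonedge u₀ u₁ h01 hcu
  obtain ⟨q, hq, hqv⟩ := hnonedge v₀ v₁ h23 hcv
  have h₀₁ : c u₀ ≠ c v₁ := hcv ▸ hcuv
  have h₁₀ : c u₁ ≠ c v₀ := hcu ▸ hcuv
  have h₁₁ : c u₁ ≠ c v₁ := hcu ▸ h₀₁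
  exact WitnessedCycle.openSegment_inter (p := p) (q := q)
    ⟨hneg u₀, hneg u₁, hneg v₀, hneg v₁, by rw [hφ]; linarith [hP p hp],
      by rw [hφ]; linarith [hP q hq],
      ⟨hpu, hedge _ _ hcuv p hp, hedge _ _ h₀₁ p hp, hedge _ _ h₁₀ p hp, hedge _ _ h₁₁ p hp⟩,
      ⟨hqv, hedge _ _ hcuv.symm q hq, hedge _ _ h₁₀.symm q hq, hedge _ _ h₀₁.symm q hq,
        hedge _ _ h₁₁.symm q hq⟩⟩
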